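/- arXiv:2307.01179 — 2 statements merged into one kernel-verified Lean document; each statement's English description precedes it below -/
import Mathlib

section
/- Let g, h ∈ Ȳ₁ and let (h_n)_{n∈ℕ} be a sequence in Ȳ₁ such that ‖h_n − h‖_{L¹(ℝ)} → 0 as n → ∞. Assume that the H^{1/2} seminorms ‖g‖₁², ‖h‖₁², and ‖h_n‖₁² (for all n) are finite. Then ‖g − h_n‖₁² → ‖g − h‖₁² as n → ∞. -/
open MeasureTheory Filter Topology

/-- The set `Ȳ₁`: functions `h : ℝ → [0,∞)` that are 2-Lipschitz, non-decreasing on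
`(−∞, 0]`, non-increasing on `[0, ∞)`, and with total integral `1`. -/
def MemY1bar (h : ℝ → ℝ) : Prop :=
  (∀ x, 0 ≤ h x) ∧ LipschitzWith 2 h ∧ MonotoneOn h (Set.Iic 0) ∧
    AntitoneOn h (Set.Ici 0) ∧ (∫ x, h x) = 1

/-- The Fourier transform `ψ̂(ω) = ∫ e^{−2πiωx} ψ(x) dx` of a real function. -/
noncomputable def ft (ψ : ℝ → ℝ) (ω : ℝ) : ℂ :=
  ∫ x : ℝ, Complex.exp (Complex.I * Complex.ofReal (-(2 * Real.pi * ω * x))) * (ψ x : ℂ)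

/-- The square of the Sobolev `H^{1/2}` seminorm, `‖ψ‖₁² = ∫ |ω| |ψ̂(ω)|² dω`. -/
noncomputable def sobHalfSq (ψ : ℝ → ℝ) : ℝ :=
  ∫ ω : ℝ, |ω| * ‖ft ψ ω‖ ^ 2

open scoped FourierTransform Convolution

lemma ft_eq_fourier (ψ : ℝ → ℝ) : ft ψ = 𝓕 (fun x => (ψ x : ℂ)) := by
  ext ω
  rw [Real.fourier_real_eq_integral_exp_smul, ft]
  congr 1 with x
  rw [smul_eq_mul]
  congr 2
  push_cast
  ring

lemma continuous_ft {ψ : ℝ → ℝ} (hψ : Integrable ψ) : Continuous (ft ψ) := by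
  rw [ft_eq_fourier]
  exact VectorFourier.fourierIntegral_continuous Real.continuous_fourierChar
    (by fun_prop) hψ.ofReal

lemma norm_ft_le {ψ : ℝ → ℝ} (ω : ℝ) : ‖ft ψ ω‖ ≤ ∫ x, |ψ x| := by
  refine (norm_integral_le_integral_norm _).trans (le_of_eq ?_)
  congr 1 with x
  rw [norm_mul, mul_comm Complex.I, Complex.norm_exp_ofReal_mul_I, one_mul, Complex.norm_real,
    Real.norm_eq_abs]

lemma integrable_exp_mul {ψ : ℝ → ℝ} (hψ : Integrable ψ) (ω : ℝ) :
    Integrable fun x : ℝ =>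
      Complex.exp (Complex.I * Complex.ofReal (-(2 * Real.pi * ω * x))) * (ψ x : ℂ) := by
  refine hψ.ofReal.bdd_mul (c := 1) (by fun_prop) (ae_of_all _ fun x => ?_)
  rw [mul_comm Complex.I, Complex.norm_exp_ofReal_mul_I]

lemma ft_sub {φ ψ : ℝ → ℝ} (hφ : Integrable φ) (hψ : Integrable ψ) (ω : ℝ) :
    ft (fun x => φ x - ψ x) ω = ft φ ω - ft ψ ω := by
  simp only [ft]
  rw [← integral_sub (integrable_exp_mul hφ ω) (integrable_exp_mul hψ ω)]
  congr 1 with x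
  push_cast
  ring

lemma ft_comp_add_right (ψ : ℝ → ℝ) (t ω : ℝ) :
    ft (fun x => ψ (x + t)) ω =
      Complex.exp (Complex.I * Complex.ofReal (2 * Real.pi * ω * t)) * ft ψ ω := by
  simp only [ft]
  rw [← integral_const_mul, ← integral_add_right_eq_self
    (fun x => Complex.exp (Complex.I * Complex.ofReal (2 * Real.pi * ω * t)) * _) t]
  congr 1 with x
  rw [← mul_assoc, ← Complex.exp_add]
  congr 2
  push_cast
  ring

lemma fourier_comp_neg_ofReal (ψ : ℝ → ℝ) (ω : ℝ) :
    𝓕 (fun x => (ψ (-x) : ℂ)) ω = (starRingEnd ℂ) (ft ψ ω) := by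
  rw [Real.fourier_real_eq_integral_exp_smul, ft, ← integral_conj,
    ← integral_neg_eq_self (μ := volume)]
  congr 1 with x
  rw [smul_eq_mul, map_mul, Complex.conj_ofReal, ← Complex.exp_conj, neg_neg]
  congr 2
  simp [Complex.conj_ofNat]
  ring

/-- Plancherel's identity for a bounded continuous integrable function. -/
lemma integral_norm_ft_sq {f : ℝ → ℝ} (hc : Continuous f) (hi : Integrable f) {M : ℝ}
    (hM : ∀ x, |f x| ≤ M) (h2 : Integrable fun ω => ‖ft f ω‖ ^ 2) :
    ∫ ω, ‖ft f ω‖ ^ 2 = ∫ x, f x ^ 2 := by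
  set F : ℝ → ℂ := fun x => (f x : ℂ)
  set G : ℝ → ℂ := fun x => (f (-x) : ℂ)
  have hF : Integrable F := hi.ofReal
  have hG : Integrable G := hi.comp_neg.ofReal
  have hGc : Continuous G := by fun_prop
  set K : ℝ → ℂ := F ⋆[ContinuousLinearMap.mul ℂ ℂ] G
  have hKc : Continuous K := by
    refine BddAbove.continuous_convolution_right_of_integrable _ ⟨M, ?_⟩ hF hGc
    rintro _ ⟨x, rfl⟩
    simpa [G] using hM (-x)
  have hKi : Integrable K := hF.integrable_convolution _ hG
  have hKf : 𝓕 K = fun ω => ((‖ft f ω‖ ^ 2 : ℝ) : ℂ) := by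
    ext ω
    rw [Real.fourier_mul_convolution_eq hF hG, fourier_comp_neg_ofReal, ← ft_eq_fourier,
      Complex.mul_conj, Complex.normSq_eq_norm_sq]
  have key : 𝓕⁻ (𝓕 K) 0 = K 0 :=
    hKi.fourierInv_fourier_eq (by rw [hKf]; exact h2.ofReal) hKc.continuousAt
  have hK0 : K 0 = ((∫ x, f x ^ 2 : ℝ) : ℂ) := by
    rw [← integral_complex_ofReal]
    simp [K, convolution, F, G, sq]
  rw [hKf, hK0, Real.fourierInv_eq] at key
  simp only [inner_zero_right, AddChar.map_zero_eq_one, one_smul] at key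
  rw [integral_complex_ofReal] at key
  exact_mod_cast key

namespace MemY1bar

variable {h : ℝ → ℝ}

lemma integrable (hh : MemY1bar h) : Integrable h := by
  by_contra H
  have := hh.2.2.2.2
  rw [integral_undef H] at this
  norm_num at this

lemma continuous (hh : MemY1bar h) : Continuous h := hh.2.1.continuous

lemma abs_sub_le (hh : MemY1bar h) (x y : ℝ) : |h x - h y| ≤ 2 * |x - y| := by
  simpa [Real.dist_eq] using hh.2.1.dist_le_mul x y

lemma le_three (hh : MemY1bar h) (x : ℝ) : h x ≤ 3 := by
  have h0 : h x ≤ h 0 := by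
    rcases le_total x 0 with hx | hx
    · exact hh.2.2.1 hx (Set.mem_Iic.2 le_rfl) hx
    · exact hh.2.2.2.1 (Set.mem_Ici.2 le_rfl) hx hx
  have h1 : ∫ _ in Set.Icc (0 : ℝ) 1, (h 0 - 2) ≤ ∫ x in Set.Icc (0 : ℝ) 1, h x := by
    refine setIntegral_mono_on (by simp) hh.integrable.integrableOn measurableSet_Icc ?_
    intro y hy
    have := hh.abs_sub_le 0 y
    rw [zero_sub, abs_neg, abs_of_nonneg hy.1] at this
    have := (abs_le.1 this).2
    linarith [hy.2]
  have h2 : ∫ x in Set.Icc (0 : ℝ) 1, h x ≤ ∫ x, h x :=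
    setIntegral_le_integral hh.integrable (ae_of_all _ hh.1)
  rw [hh.2.2.2.2] at h2
  simp at h1
  linarith

lemma abs_sub_le_three {g : ℝ → ℝ} (hg : MemY1bar g) (hh : MemY1bar h) (x y : ℝ) :
    |g x - h y| ≤ 3 := by
  rw [abs_le]
  constructor <;> linarith [hg.1 x, hh.1 y, hg.le_three x, hh.le_three y]

lemma integral_abs_translate_sub_le (hh : MemY1bar h) {t : ℝ} (ht : 0 < t) :
    ∫ x, |h (x + t) - h x| ≤ 6 * t + 4 * t ^ 2 := by
  have hi := hh.integrable
  have hit : Integrable fun x => h (x + t) := hi.comp_add_right t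
  set A : ℝ → ℝ := (Set.Ici (0 : ℝ)).indicator h
  set B : ℝ → ℝ := (Set.Ici t).indicator h
  have hA : Integrable A := hi.indicator measurableSet_Ici
  have hB : Integrable B := hi.indicator measurableSet_Ici
  have hBt : Integrable fun x => B (x + t) := hB.comp_add_right t
  set C : ℝ → ℝ := (Set.Icc (-t) 0).indicator fun _ => 4 * t
  have hC : Integrable C := by
    have : IntegrableOn (fun _ => 4 * t) (Set.Icc (-t) 0) := continuous_const.integrableOn_Icc
    exact this.integrable_indicator measurableSet_Icc
  have hAB : ∫ x, (A x - B x) ≤ 3 * t := by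
    have : ∀ x, A x - B x ≤ (Set.Icc 0 t).indicator (fun _ => (3 : ℝ)) x := by
      intro x
      simp only [A, B, Set.indicator_apply, Set.mem_Ici, Set.mem_Icc]
      have := hh.le_three x
      split_ifs <;> first | linarith | (exfalso; grind)
    refine (integral_mono (hA.sub hB) ?_ this).trans ?_
    · exact (integrable_indicator_iff measurableSet_Icc).2 (by simp)
    · rw [integral_indicator measurableSet_Icc]
      simp [ht.le, mul_comm]
  have key : ∀ x, |h (x + t) - h x| ≤
      2 * (A x - B (x + t)) + (h (x + t) - h x) + C x := by
    intro x
    simp only [A, B, C, Set.indicator_apply, Set.mem_Ici, Set.mem_Icc]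
    rcases le_or_gt 0 x with hx | hx
    · have := hh.2.2.2.1 (Set.mem_Ici.2 hx) (Set.mem_Ici.2 (by linarith : 0 ≤ x + t))
        (by linarith)
      rw [abs_of_nonpos (by linarith), if_pos hx, if_pos (by linarith)]
      split_ifs <;> linarith
    · rw [if_neg hx.not_ge, if_neg (by linarith)]
      rcases le_or_gt x (-t) with hx' | hx'
      · have := hh.2.2.1 (Set.mem_Iic.2 hx.le) (Set.mem_Iic.2 (by linarith : x + t ≤ 0))
          (by linarith)
        rw [abs_of_nonneg (by linarith)]
        split_ifs <;> linarith
      · have := hh.abs_sub_le (x + t) x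
        rw [add_sub_cancel_left, abs_of_pos ht] at this
        rw [if_pos ⟨hx'.le, hx.le⟩]
        linarith [(abs_le.1 this).1]
  have hAB' : ∫ x, (A x - B (x + t)) = ∫ x, (A x - B x) := by
    rw [integral_sub hA hBt, integral_sub hA hB, integral_add_right_eq_self B t]
  have hCi : ∫ x, C x = 4 * t ^ 2 := by
    rw [integral_indicator measurableSet_Icc]
    simp [ht.le]
    ring
  calc ∫ x, |h (x + t) - h x|
      ≤ ∫ x, (2 * (A x - B (x + t)) + (h (x + t) - h x) + C x) :=
        integral_mono (hit.sub hi).abs ((((hA.sub hBt).const_mul 2).add (hit.sub hi)).add hC) key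
    _ = 2 * (∫ x, (A x - B x)) + 4 * t ^ 2 := by
      have hABi : Integrable fun x => 2 * (A x - B (x + t)) := (hA.sub hBt).const_mul 2
      have hhi : Integrable fun x => h (x + t) - h x := hit.sub hi
      have hsi : Integrable fun x => 2 * (A x - B (x + t)) + (h (x + t) - h x) := hABi.add hhi
      rw [integral_add hsi hC, integral_add hABi hhi, integral_const_mul, hAB', hCi,
        integral_sub hit hi, integral_add_right_eq_self h t]
      ring
    _ ≤ _ := by linarith

end MemY1bar

lemma integrable_norm_ft_sq {ψ : ℝ → ℝ} (hψ : Integrable ψ)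
    (h : Integrable fun ω => |ω| * ‖ft ψ ω‖ ^ 2) : Integrable fun ω => ‖ft ψ ω‖ ^ 2 := by
  have hc : Continuous (ft ψ) := continuous_ft hψ
  have h1 : Integrable ((Set.Icc (-1 : ℝ) 1).indicator fun _ => (∫ x, |ψ x|) ^ 2) :=
    (integrable_indicator_iff measurableSet_Icc).2 (by simp)
  refine (h1.add h).mono' (by fun_prop) (ae_of_all _ fun ω => ?_)
  rw [Real.norm_of_nonneg (by positivity), Pi.add_apply, Set.indicator_apply]
  split_ifs with hω
  · have := pow_le_pow_left₀ (norm_nonneg _) (norm_ft_le (ψ := ψ) ω) 2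
    have : 0 ≤ |ω| * ‖ft ψ ω‖ ^ 2 := by positivity
    linarith
  · have : 1 ≤ |ω| := by
      by_contra! H
      exact hω (abs_le.1 H.le)
    nlinarith [sq_nonneg ‖ft ψ ω‖]

lemma norm_exp_sub_one_ge {ω t : ℝ} (ht : |ω * t| ≤ 1 / 2) :
    4 * |ω * t| ≤ ‖Complex.exp (Complex.I * Complex.ofReal (2 * Real.pi * ω * t)) - 1‖ := by
  have hp := Real.pi_pos
  have h1 := Real.mul_le_sin (x := Real.pi * |ω * t|) (by positivity) (by nlinarith)
  have h2 : 2 / Real.pi * (Real.pi * |ω * t|) = 2 * |ω * t| := by field_simp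
  have h3 : Real.sin (Real.pi * |ω * t|) ≤ |Real.sin (Real.pi * (ω * t))| := by
    rcases abs_cases (ω * t) with ⟨h, -⟩ | ⟨h, -⟩ <;> rw [h]
    · exact le_abs_self _
    · rw [mul_neg, Real.sin_neg]
      exact neg_le_abs _
  rw [Complex.norm_exp_I_mul_ofReal_sub_one, norm_mul, Real.norm_eq_abs, Real.norm_eq_abs,
    show 2 * Real.pi * ω * t / 2 = Real.pi * (ω * t) by ring, abs_two]
  linarith

namespace MemY1bar

variable {h : ℝ → ℝ}

lemma integral_sq_mul_norm_ft_sq_le (hh : MemY1bar h)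
    (hf : Integrable fun ω => |ω| * ‖ft h ω‖ ^ 2) {T : ℝ} (hT : 1 ≤ T) :
    ∫ ω in -T..T, ω ^ 2 * ‖ft h ω‖ ^ 2 ≤ 1 := by
  have hi := hh.integrable
  have hT0 : 0 < T := by linarith
  set t : ℝ := 1 / (2 * T)
  have ht : 0 < t := by positivity
  have ht2 : t ≤ 1 / 2 := by
    simp only [t]
    gcongr
    linarith
  have hTt : T * t = 1 / 2 := by
    simp only [t]
    field_simp
  set f : ℝ → ℝ := fun x => h (x + t) - h x
  have hfi : Integrable f := (hi.comp_add_right t).sub hi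
  have hfc : Continuous f := by
    have := hh.continuous
    fun_prop
  have hft : ∀ ω, ft f ω =
      (Complex.exp (Complex.I * Complex.ofReal (2 * Real.pi * ω * t)) - 1) * ft h ω := by
    intro ω
    rw [ft_sub (hi.comp_add_right t) hi, ft_comp_add_right]
    ring
  have h2 := integrable_norm_ft_sq hi hf
  have hcf := continuous_ft hfi
  have hch := continuous_ft hi
  have hf2 : Integrable fun ω => ‖ft f ω‖ ^ 2 := by
    refine (h2.const_mul 4).mono' (by fun_prop) (ae_of_all _ fun ω => ?_)
    rw [Real.norm_of_nonneg (by positivity), hft, norm_mul, mul_pow]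
    gcongr
    have : ‖Complex.exp (Complex.I * Complex.ofReal (2 * Real.pi * ω * t)) - 1‖ ≤ 2 := by
      refine (norm_sub_le _ _).trans ?_
      rw [mul_comm Complex.I, Complex.norm_exp_ofReal_mul_I, norm_one]
      norm_num
    nlinarith [norm_nonneg (Complex.exp (Complex.I * Complex.ofReal (2 * Real.pi * ω * t)) - 1)]
  have hP := integral_norm_ft_sq hfc hfi (fun x => hh.abs_sub_le_three hh _ _) hf2
  have hsq : ∫ x, f x ^ 2 ≤ 16 * t ^ 2 := by
    have : ∀ x, f x ^ 2 ≤ 2 * t * |f x| := by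
      intro x
      have := hh.abs_sub_le (x + t) x
      rw [add_sub_cancel_left, abs_of_pos ht] at this
      rw [← sq_abs, sq]
      gcongr
    calc ∫ x, f x ^ 2 ≤ ∫ x, 2 * t * |f x| :=
          integral_mono_of_nonneg (ae_of_all _ fun x => sq_nonneg _) (hfi.abs.const_mul _)
            (ae_of_all _ this)
      _ = 2 * t * ∫ x, |f x| := integral_const_mul _ _
      _ ≤ 2 * t * (6 * t + 4 * t ^ 2) := by
          gcongr
          exact hh.integral_abs_translate_sub_le ht
      _ ≤ 16 * t ^ 2 := by nlinarith [mul_pos ht ht]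
  have hle : ∫ ω in -T..T, 16 * t ^ 2 * (ω ^ 2 * ‖ft h ω‖ ^ 2) ≤ ∫ ω, ‖ft f ω‖ ^ 2 := by
    have h3 : ∫ ω in -T..T, 16 * t ^ 2 * (ω ^ 2 * ‖ft h ω‖ ^ 2) ≤
        ∫ ω in -T..T, ‖ft f ω‖ ^ 2 := by
      refine intervalIntegral.integral_mono_on (by linarith)
        (Continuous.intervalIntegrable (by fun_prop) _ _)
        (Continuous.intervalIntegrable (by fun_prop) _ _) fun ω hω => ?_
      have hωt : |ω * t| ≤ 1 / 2 := by
        rw [abs_mul, abs_of_pos ht, ← hTt]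
        gcongr
        exact abs_le.2 hω
      have := pow_le_pow_left₀ (by positivity) (norm_exp_sub_one_ge hωt) 2
      rw [mul_pow, sq_abs, mul_pow] at this
      rw [hft, norm_mul, mul_pow]
      calc 16 * t ^ 2 * (ω ^ 2 * ‖ft h ω‖ ^ 2) = 4 ^ 2 * (ω ^ 2 * t ^ 2) * ‖ft h ω‖ ^ 2 := by ring
        _ ≤ _ := by gcongr
    refine h3.trans ?_
    rw [intervalIntegral.integral_of_le (by linarith)]
    exact setIntegral_le_integral hf2 (ae_of_all _ fun ω => by positivity)
  rw [intervalIntegral.integral_const_mul] at hle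
  have : 0 < 16 * t ^ 2 := by positivity
  nlinarith

lemma integrable_abs_mul_norm_ft_sub_sq {g : ℝ → ℝ} (hg : MemY1bar g) (hh : MemY1bar h)
    (hfg : Integrable fun ω => |ω| * ‖ft g ω‖ ^ 2)
    (hfh : Integrable fun ω => |ω| * ‖ft h ω‖ ^ 2) :
    Integrable fun ω => |ω| * ‖ft (fun x => g x - h x) ω‖ ^ 2 := by
  have hc := continuous_ft (hg.integrable.sub hh.integrable)
  refine ((hfg.add hfh).const_mul 2).mono' ?_ (ae_of_all _ fun ω => ?_)
  · exact Continuous.aestronglyMeasurable (continuous_abs.mul (hc.norm.pow 2))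
  · rw [Real.norm_of_nonneg (by positivity), ft_sub hg.integrable hh.integrable, Pi.add_apply,
      ← mul_add, mul_left_comm]
    gcongr
    have := norm_sub_le (ft g ω) (ft h ω)
    nlinarith [sq_nonneg (‖ft g ω‖ - ‖ft h ω‖), norm_nonneg (ft g ω - ft h ω)]

/-- Interpolation between the `L¹` distance and the uniform `H¹` bound. -/
lemma sobHalfSq_sub_le {g : ℝ → ℝ} (hg : MemY1bar g) (hh : MemY1bar h)
    (hfg : Integrable fun ω => |ω| * ‖ft g ω‖ ^ 2)
    (hfh : Integrable fun ω => |ω| * ‖ft h ω‖ ^ 2) {R : ℝ} (hR : 0 < R) :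
    sobHalfSq (fun x => g x - h x) ≤ R * (3 * ∫ x, |g x - h x|) + 4 / R := by
  have hψ : Integrable fun x => g x - h x := hg.integrable.sub hh.integrable
  have hfψ := hg.integrable_abs_mul_norm_ft_sub_sq hh hfg hfh
  have h2 := integrable_norm_ft_sq hψ hfψ
  have hcg := continuous_ft hg.integrable
  have hch := continuous_ft hh.integrable
  have hcψ := continuous_ft hψ
  have hP : ∫ ω, ‖ft (fun x => g x - h x) ω‖ ^ 2 ≤ 3 * ∫ x, |g x - h x| := by
    rw [integral_norm_ft_sq (f := fun x => g x - h x) (hg.continuous.sub hh.continuous) hψ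
      (fun x => hg.abs_sub_le_three hh x x) h2, ← integral_const_mul]
    refine integral_mono_of_nonneg (ae_of_all _ fun x => sq_nonneg _) (hψ.abs.const_mul _)
      (ae_of_all _ fun x => ?_)
    have := hg.abs_sub_le_three hh x x
    simp only
    rw [← sq_abs, sq]
    gcongr
  refine le_of_tendsto
    (intervalIntegral_tendsto_integral hfψ tendsto_neg_atTop_atBot tendsto_id) ?_
  filter_upwards [eventually_ge_atTop (1 : ℝ)] with T hT
  have hTT : -T ≤ T := by linarith
  calc ∫ ω in -T..T, |ω| * ‖ft (fun x => g x - h x) ω‖ ^ 2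
      ≤ ∫ ω in -T..T, (R * ‖ft (fun x => g x - h x) ω‖ ^ 2 +
          2 / R * (ω ^ 2 * ‖ft g ω‖ ^ 2 + ω ^ 2 * ‖ft h ω‖ ^ 2)) := by
        refine intervalIntegral.integral_mono_on hTT
          (Continuous.intervalIntegrable (by fun_prop) _ _)
          (Continuous.intervalIntegrable (by fun_prop) _ _) fun ω _ => ?_
        have h3 : |ω| ≤ R + ω ^ 2 / R := by
          rw [← sub_nonneg]
          have : R + ω ^ 2 / R - |ω| = ((R - |ω| / 2) ^ 2 + 3 / 4 * |ω| ^ 2) / R := by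
            rw [← sq_abs ω]
            field_simp
            ring
          rw [this]
          positivity
        have h4 : ‖ft (fun x => g x - h x) ω‖ ^ 2 ≤ 2 * (‖ft g ω‖ ^ 2 + ‖ft h ω‖ ^ 2) := by
          rw [ft_sub hg.integrable hh.integrable]
          have := norm_sub_le (ft g ω) (ft h ω)
          nlinarith [sq_nonneg (‖ft g ω‖ - ‖ft h ω‖), norm_nonneg (ft g ω - ft h ω)]
        calc |ω| * ‖ft (fun x => g x - h x) ω‖ ^ 2
            ≤ (R + ω ^ 2 / R) * ‖ft (fun x => g x - h x) ω‖ ^ 2 := by gcongr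
          _ = R * ‖ft (fun x => g x - h x) ω‖ ^ 2 +
              ω ^ 2 / R * ‖ft (fun x => g x - h x) ω‖ ^ 2 := by ring
          _ ≤ R * ‖ft (fun x => g x - h x) ω‖ ^ 2 +
              ω ^ 2 / R * (2 * (‖ft g ω‖ ^ 2 + ‖ft h ω‖ ^ 2)) := by gcongr
          _ = _ := by ring
    _ = R * (∫ ω in -T..T, ‖ft (fun x => g x - h x) ω‖ ^ 2) +
          2 / R * ((∫ ω in -T..T, ω ^ 2 * ‖ft g ω‖ ^ 2) +
            ∫ ω in -T..T, ω ^ 2 * ‖ft h ω‖ ^ 2) := by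
        rw [intervalIntegral.integral_add (Continuous.intervalIntegrable (by fun_prop) _ _)
          (Continuous.intervalIntegrable (by fun_prop) _ _), intervalIntegral.integral_const_mul,
          intervalIntegral.integral_const_mul,
          intervalIntegral.integral_add (Continuous.intervalIntegrable (by fun_prop) _ _)
          (Continuous.intervalIntegrable (by fun_prop) _ _)]
    _ ≤ R * (3 * ∫ x, |g x - h x|) + 2 / R * (1 + 1) := by
        gcongr
        · refine le_trans ?_ hP
          rw [intervalIntegral.integral_of_le hTT]
          exact setIntegral_le_integral h2 (ae_of_all _ fun ω => by positivity)
        · exact hg.integral_sq_mul_norm_ft_sq_le hfg hT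
        · exact hh.integral_sq_mul_norm_ft_sq_le hfh hT
    _ = _ := by ring

end MemY1bar

lemma sobHalfSq_nonneg (ψ : ℝ → ℝ) : 0 ≤ sobHalfSq ψ :=
  integral_nonneg fun _ => by positivity

lemma abs_norm_sub_sq_sub_norm_sq_le {E : Type*} [SeminormedAddCommGroup E] (a b : E) {δ : ℝ}
    (hδ : 0 < δ) : |‖a - b‖ ^ 2 - ‖a‖ ^ 2| ≤ δ * ‖a‖ ^ 2 + (1 / δ + 1) * ‖b‖ ^ 2 := by
  have h1 := norm_sub_le a b
  have h2 := norm_sub_norm_le a b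
  have h3 := norm_nonneg a
  have h4 := norm_nonneg b
  have h5 := norm_nonneg (a - b)
  have h6 : 2 * (‖a‖ * ‖b‖) ≤ δ * ‖a‖ ^ 2 + 1 / δ * ‖b‖ ^ 2 := by
    have : δ * ‖a‖ ^ 2 + 1 / δ * ‖b‖ ^ 2 - 2 * (‖a‖ * ‖b‖) = (δ * ‖a‖ - ‖b‖) ^ 2 / δ := by
      field_simp
      ring
    have : 0 ≤ (δ * ‖a‖ - ‖b‖) ^ 2 / δ := by positivity
    linarith
  rw [abs_le]
  constructor
  · rcases le_total ‖b‖ ‖a‖ with h | h <;> nlinarith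
  · nlinarith

lemma abs_sobHalfSq_sub_sub_le {φ ψ : ℝ → ℝ} (hφ : Integrable φ) (hψ : Integrable ψ)
    (hfφ : Integrable fun ω => |ω| * ‖ft φ ω‖ ^ 2)
    (hfψ : Integrable fun ω => |ω| * ‖ft ψ ω‖ ^ 2)
    (hfs : Integrable fun ω => |ω| * ‖ft (fun x => φ x - ψ x) ω‖ ^ 2) {δ : ℝ} (hδ : 0 < δ) :
    |sobHalfSq (fun x => φ x - ψ x) - sobHalfSq φ| ≤
      δ * sobHalfSq φ + (1 / δ + 1) * sobHalfSq ψ := by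
  simp only [sobHalfSq]
  rw [← integral_sub hfs hfφ, ← integral_const_mul, ← integral_const_mul,
    ← integral_add (hfφ.const_mul _) (hfψ.const_mul _)]
  refine abs_integral_le_integral_abs.trans (integral_mono (hfs.sub hfφ).abs
    ((hfφ.const_mul _).add (hfψ.const_mul _)) fun ω => ?_)
  simp only
  rw [ft_sub hφ hψ, ← mul_sub, abs_mul, abs_abs]
  calc |ω| * |‖ft φ ω - ft ψ ω‖ ^ 2 - ‖ft φ ω‖ ^ 2|
      ≤ |ω| * (δ * ‖ft φ ω‖ ^ 2 + (1 / δ + 1) * ‖ft ψ ω‖ ^ 2) := by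
        gcongr
        exact abs_norm_sub_sq_sub_norm_sq_le _ _ hδ
    _ = _ := by ring

/-- If `g, h, h_n ∈ Ȳ₁`, `h_n → h` in `L¹`, and the `H^{1/2}` seminorms of `g`, `h` and
all `h_n` are finite, then `‖g − h_n‖₁² → ‖g − h‖₁²`. -/
theorem sobolev_half_continuity (g h : ℝ → ℝ) (hg : MemY1bar g) (hh : MemY1bar h)
    (hn : ℕ → ℝ → ℝ) (hhn : ∀ n, MemY1bar (hn n))
    (hL1 : Tendsto (fun n => ∫ x, |hn n x - h x|) atTop (nhds 0))
    (hfin_g : Integrable fun ω => |ω| * ‖ft g ω‖ ^ 2)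
    (hfin_h : Integrable fun ω => |ω| * ‖ft h ω‖ ^ 2)
    (hfin_n : ∀ n, Integrable fun ω => |ω| * ‖ft (hn n) ω‖ ^ 2) :
    Tendsto (fun n => sobHalfSq (fun x => g x - hn n x)) atTop
      (nhds (sobHalfSq (fun x => g x - h x))) := by
  have hD : Tendsto (fun n => sobHalfSq (fun x => hn n x - h x)) atTop (𝓝 0) := by
    rw [Metric.tendsto_atTop']
    intro ε hε
    have h1 : Tendsto (fun n => 8 / ε * (3 * ∫ x, |hn n x - h x|)) atTop (𝓝 0) := by
      simpa using (hL1.const_mul 3).const_mul (8 / ε)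
    obtain ⟨N, hN⟩ := eventually_atTop.1 (h1.eventually (gt_mem_nhds (half_pos hε)))
    refine ⟨N, fun n hnN => ?_⟩
    rw [Real.dist_eq, sub_zero, abs_of_nonneg (sobHalfSq_nonneg _)]
    have h2 := (hhn n).sobHalfSq_sub_le hh (hfin_n n) hfin_h (R := 8 / ε) (by positivity)
    have h3 : 4 / (8 / ε) = ε / 2 := by
      field_simp
      norm_num
    linarith [hN n hnN.le]
  set S := sobHalfSq (fun x => g x - h x)
  have hS : 0 ≤ S := sobHalfSq_nonneg _
  rw [Metric.tendsto_atTop']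
  intro ε hε
  set δ : ℝ := ε / (2 * (S + 1))
  have hδ : 0 < δ := by positivity
  have hδS : δ * S < ε / 2 := by
    have : δ * (S + 1) = ε / 2 := by
      simp only [δ]
      field_simp
    linarith
  have h1 : Tendsto (fun n => (1 / δ + 1) * sobHalfSq (fun x => hn n x - h x)) atTop (𝓝 0) := by
    simpa using hD.const_mul (1 / δ + 1)
  obtain ⟨N, hN⟩ := eventually_atTop.1 (h1.eventually (gt_mem_nhds (half_pos hε)))
  refine ⟨N, fun n hnN => ?_⟩
  have heq : (fun x => g x - hn n x) = fun x => (g x - h x) - (hn n x - h x) := by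
    ext x
    ring
  have h2 := abs_sobHalfSq_sub_sub_le (φ := fun x => g x - h x) (ψ := fun x => hn n x - h x)
    (hg.integrable.sub hh.integrable)
    ((hhn n).integrable.sub hh.integrable)
    (hg.integrable_abs_mul_norm_ft_sub_sq hh hfin_g hfin_h)
    ((hhn n).integrable_abs_mul_norm_ft_sub_sq hh (hfin_n n) hfin_h)
    (by
      have := hg.integrable_abs_mul_norm_ft_sub_sq (hhn n) hfin_g (hfin_n n)
      rwa [heq] at this) hδ
  rw [Real.dist_eq, heq]
  refine h2.trans_lt ?_
  linarith [hN n hnN.le]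
end

section
/- Fix φ ∈ 𝒴₁ with I_hook(φ) < ∞. Then there exists a sequence of integer partitions λ^{(n)}, with λ^{(n)} a partition of n for each n, such that ‖φ_{λ^{(n)}} − φ‖_{L¹([0,∞))} → 0 and I_hook(φ_{λ^{(n)}}) → I_hook(φ) as n → ∞. -/
open MeasureTheory Filter Topology

/-- The set `𝒴₁`: weakly decreasing functions `φ : [0,∞) → [0,∞)` with unit integral. -/
def MemYone (φ : ℝ → ℝ) : Prop :=
  (∀ x, 0 ≤ x → 0 ≤ φ x) ∧ AntitoneOn φ (Set.Ici 0) ∧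
    (∫ x in Set.Ioi (0 : ℝ), φ x) = 1

/-- The generalized inverse `φ⁻¹(y) = inf {x ≥ 0 : φ(x) ≤ y}`. -/
noncomputable def phiInv (φ : ℝ → ℝ) (y : ℝ) : ℝ :=
  sInf {x : ℝ | 0 ≤ x ∧ φ x ≤ y}

/-- The hook integral `I_hook(φ) = ∫₀^∞ ∫₀^{φ(x)} log(φ(x) + φ⁻¹(y) − x − y) dy dx`. -/
noncomputable def Ihook (φ : ℝ → ℝ) : ℝ :=
  ∫ p in {p : ℝ × ℝ | 0 < p.1 ∧ 0 < p.2 ∧ p.2 < φ p.1},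
    Real.log (φ p.1 + phiInv φ p.2 - p.1 - p.2)

/-- `l : ℕ → ℕ` encodes a partition of `n` (with `l i = λ_{i+1}`): it is weakly
decreasing, eventually zero, and its parts sum to `n`. -/
def IsPartitionOf (n : ℕ) (l : ℕ → ℕ) : Prop :=
  (∀ i j, i ≤ j → l j ≤ l i) ∧ (∃ N, ∀ i ≥ N, l i = 0) ∧
    (∑' i : ℕ, (l i : ℝ)) = n

/-- The rescaled shape `φ_λ(x) = n^{-1/2}·λ_{⌊x√n⌋+1}` of a partition `λ` of `n`. -/
noncomputable def phiOf (n : ℕ) (l : ℕ → ℕ) (x : ℝ) : ℝ :=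
  (l ⌊x * Real.sqrt n⌋₊ : ℝ) / Real.sqrt n

section PhiInv

variable {ψ : ℝ → ℝ}

/-- The region `{0 < x, 0 < y < ψ x}` under the graph of `ψ`. -/
def hookRegion (ψ : ℝ → ℝ) : Set (ℝ × ℝ) := {p | 0 < p.1 ∧ 0 < p.2 ∧ p.2 < ψ p.1}

/-- The hook length of `ψ` at a point. -/
noncomputable def hookLength (ψ : ℝ → ℝ) (p : ℝ × ℝ) : ℝ := ψ p.1 + phiInv ψ p.2 - p.1 - p.2

/-- Bounded shapes whose value tends to zero at infinity. -/
structure IsShape (ψ : ℝ → ℝ) : Prop where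
  antitone : Antitone ψ
  nonneg : ∀ x, 0 ≤ ψ x
  decay : ∀ y, 0 < y → ∃ x, 0 ≤ x ∧ ψ x ≤ y

lemma bddBelow_phiInv (ψ : ℝ → ℝ) (y : ℝ) : BddBelow {x : ℝ | 0 ≤ x ∧ ψ x ≤ y} :=
  ⟨0, fun _ h => h.1⟩

lemma phiInv_nonneg (ψ : ℝ → ℝ) (y : ℝ) : 0 ≤ phiInv ψ y :=
  Real.sInf_nonneg fun _ h => h.1

lemma phiInv_le {x y : ℝ} (hx : 0 ≤ x) (h : ψ x ≤ y) : phiInv ψ y ≤ x :=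
  csInf_le (bddBelow_phiInv ψ y) ⟨hx, h⟩

lemma lt_of_lt_phiInv {x y : ℝ} (hx : 0 ≤ x) (h : x < phiInv ψ y) : y < ψ x := by
  by_contra! h'
  exact (phiInv_le hx h').not_gt h

lemma measurableSet_hookRegion (hψ : Measurable ψ) : MeasurableSet (hookRegion ψ) :=
  (measurableSet_lt measurable_const measurable_fst).inter
    ((measurableSet_lt measurable_const measurable_snd).inter
      (measurableSet_lt measurable_snd (hψ.comp measurable_fst)))

lemma horizontal_le_hookLength {p : ℝ × ℝ} (hp : p ∈ hookRegion ψ) :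
    phiInv ψ p.2 - p.1 ≤ hookLength ψ p := by
  have := hp.2.2
  unfold hookLength
  linarith

namespace IsShape

lemma le_phiInv (hψ : IsShape ψ) {x y : ℝ} (hy : 0 < y) (h : y < ψ x) : x ≤ phiInv ψ y :=
  le_csInf (hψ.decay y hy) fun _ hz => (hψ.antitone.reflect_lt (hz.2.trans_lt h)).le

lemma antitoneOn_phiInv (hψ : IsShape ψ) : AntitoneOn (phiInv ψ) (Set.Ioi 0) :=
  fun y hy _ _ hyz => csInf_le_csInf (bddBelow_phiInv ψ _) (hψ.decay y hy)
    fun _ hx => ⟨hx.1, hx.2.trans hyz⟩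

lemma monotoneOn_phiInv (hψ : IsShape ψ) : MonotoneOn (phiInv ψ) (Set.Ioi 0)ᶜ := by
  intro y _ z hz hyz
  rcases hyz.eq_or_lt with rfl | h
  · rfl
  · have hy : y < 0 := h.trans_le (not_lt.1 hz)
    have : {x : ℝ | 0 ≤ x ∧ ψ x ≤ y} = ∅ := by
      ext x
      simpa using fun _ => hy.trans_le (hψ.nonneg x)
    rw [phiInv, this, Real.sInf_empty]
    exact phiInv_nonneg ψ z

lemma measurable_phiInv (hψ : IsShape ψ) : Measurable (phiInv ψ) := by
  have : Set.OrdConnected (Set.Ioi (0 : ℝ))ᶜ := by rw [Set.compl_Ioi]; infer_instance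
  refine measurable_of_restrict_of_restrict_compl (s := Set.Ioi 0) measurableSet_Ioi ?_ ?_
  · exact Antitone.measurable fun a b h => hψ.antitoneOn_phiInv a.2 b.2 h
  · exact Monotone.measurable fun a b h => hψ.monotoneOn_phiInv a.2 b.2 h

lemma measurable_hookLength (hψ : IsShape ψ) : Measurable (hookLength ψ) := by
  have h1 := hψ.antitone.measurable
  have h2 := hψ.measurable_phiInv
  unfold hookLength
  fun_prop

lemma measurableSet_hookRegion (hψ : IsShape ψ) : MeasurableSet (hookRegion ψ) :=
  _root_.measurableSet_hookRegion hψ.antitone.measurable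

lemma vertical_le_hookLength (hψ : IsShape ψ) {p : ℝ × ℝ} (hp : p ∈ hookRegion ψ) :
    ψ p.1 - p.2 ≤ hookLength ψ p := by
  have := hψ.le_phiInv hp.2.1 hp.2.2
  unfold hookLength
  linarith

lemma hookLength_pos (hψ : IsShape ψ) {p : ℝ × ℝ} (hp : p ∈ hookRegion ψ) :
    0 < hookLength ψ p :=
  (sub_pos.2 hp.2.2).trans_le (hψ.vertical_le_hookLength hp)

end IsShape

end PhiInv

section LogSingularity

/-- The positive part of `log (δ / t)` for `t > 0`, extended by `∞` at `0` and by `0` to `t < 0`. -/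
noncomputable def logDefect (δ t : ℝ) : ENNReal :=
  if t = 0 then ⊤ else if t < 0 then 0 else ENNReal.ofReal (Real.log δ - Real.log t)

lemma measurable_logDefect (δ : ℝ) : Measurable (logDefect δ) := by
  unfold logDefect
  refine Measurable.ite (measurableSet_singleton 0) measurable_const
    (Measurable.ite measurableSet_Iio measurable_const ?_)
  fun_prop

lemma lintegral_logDefect {δ : ℝ} (hδ : 0 < δ) : ∫⁻ t, logDefect δ t = ENNReal.ofReal δ := by
  have h1 : ∫⁻ t, logDefect δ t
      = ∫⁻ t in Set.Ioc 0 δ, ENNReal.ofReal (Real.log δ - Real.log t) := by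
    rw [← lintegral_indicator measurableSet_Ioc]
    refine lintegral_congr_ae ?_
    filter_upwards [(measure_singleton (0 : ℝ) : volume {(0 : ℝ)} = 0) |> compl_mem_ae_iff.2]
      with t ht
    have ht : t ≠ 0 := ht
    rcases ht.lt_or_gt with h | h
    · simp [logDefect, ht, h, not_lt.2 h.le]
    · by_cases h' : t ≤ δ
      · simp [logDefect, ht, h.not_gt, h, h']
      · have : Real.log δ - Real.log t ≤ 0 :=
          sub_nonpos.2 (Real.log_le_log hδ (not_le.1 h').le)
        simp [logDefect, ht, h.not_gt, h', this]
  have hint : IntervalIntegrable (fun t => Real.log δ - Real.log t) volume 0 δ :=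
    intervalIntegrable_const.sub intervalIntegral.intervalIntegrable_log'
  rw [h1, ← ofReal_integral_eq_lintegral_ofReal, ← intervalIntegral.integral_of_le hδ.le,
    intervalIntegral.integral_sub intervalIntegrable_const
      intervalIntegral.intervalIntegrable_log']
  · congr 1
    simp
  · exact (intervalIntegrable_iff_integrableOn_Ioc_of_le hδ.le).1 hint
  · filter_upwards [ae_restrict_mem measurableSet_Ioc] with t ht
    exact sub_nonneg.2 (Real.log_le_log ht.1 ht.2)

lemma ofReal_log_max_sub_le {δ h t : ℝ} (ht : 0 ≤ t) (hth : t ≤ h) :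
    ENNReal.ofReal (Real.log (max h δ) - Real.log h) ≤ logDefect δ t := by
  rcases ht.eq_or_lt with rfl | ht
  · simp [logDefect]
  · rw [logDefect, if_neg ht.ne', if_neg ht.not_gt]
    rcases le_total h δ with h' | h'
    · rw [max_eq_right h']
      exact ENNReal.ofReal_le_ofReal (sub_le_sub_left (Real.log_le_log ht hth) _)
    · simp [max_eq_left h']

/-- Truncating the hook length from below at `δ` changes the hook integral by `O(δ)`. -/
lemma IsShape.lintegral_log_max_sub_le {ψ : ℝ → ℝ} (hψ : IsShape ψ) {δ : ℝ} (hδ : 0 < δ) :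
    ∫⁻ p in hookRegion ψ,
        ENNReal.ofReal (Real.log (max (hookLength ψ p) δ) - Real.log (hookLength ψ p))
      ≤ ENNReal.ofReal ((1 + ψ 1) * δ) := by
  have m1 := hψ.antitone.measurable
  have m2 := hψ.measurable_phiInv
  have mL := measurable_logDefect δ
  set f : ℝ × ℝ → ENNReal :=
    fun p => (Set.Ioc 0 1).indicator (fun x => logDefect δ (ψ x - p.2)) p.1
  set g : ℝ × ℝ → ENNReal :=
    fun p => (Set.Ioo 0 (ψ 1)).indicator (fun y => logDefect δ (phiInv ψ y - p.1)) p.2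
  have mf : Measurable f := by
    have : f = (Prod.fst ⁻¹' (Set.Ioc 0 1)).indicator (fun p => logDefect δ (ψ p.1 - p.2)) := by
      ext p; simp [f, Set.indicator]
    rw [this]
    exact Measurable.indicator (by fun_prop) (measurable_fst measurableSet_Ioc)
  have mg : Measurable g := by
    have : g = (Prod.snd ⁻¹' (Set.Ioo 0 (ψ 1))).indicator
        (fun p => logDefect δ (phiInv ψ p.2 - p.1)) := by
      ext p; simp [g, Set.indicator]
    rw [this]
    exact Measurable.indicator (by fun_prop) (measurable_snd measurableSet_Ioo)
  have If : ∫⁻ p, f p = ENNReal.ofReal δ := by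
    rw [Measure.volume_eq_prod, lintegral_prod _ mf.aemeasurable]
    have : ∀ x, ∫⁻ y, f (x, y) = (Set.Ioc (0 : ℝ) 1).indicator (fun _ => ENNReal.ofReal δ) x := by
      intro x
      by_cases hx : x ∈ Set.Ioc (0 : ℝ) 1
      · simp only [f, Set.indicator_of_mem hx]
        rw [lintegral_sub_left_eq_self (logDefect δ), lintegral_logDefect hδ]
      · simp only [f, Set.indicator_of_notMem hx, lintegral_zero]
    simp_rw [this]
    simp [lintegral_indicator]
  have Ig : ∫⁻ p, g p = ENNReal.ofReal (ψ 1 * δ) := by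
    rw [Measure.volume_eq_prod, lintegral_prod_symm _ mg.aemeasurable]
    have : ∀ y, ∫⁻ x, g (x, y)
        = (Set.Ioo (0 : ℝ) (ψ 1)).indicator (fun _ => ENNReal.ofReal δ) y := by
      intro y
      by_cases hy : y ∈ Set.Ioo (0 : ℝ) (ψ 1)
      · simp only [g, Set.indicator_of_mem hy]
        rw [lintegral_sub_left_eq_self (logDefect δ), lintegral_logDefect hδ]
      · simp only [g, Set.indicator_of_notMem hy, lintegral_zero]
    simp_rw [this]
    rw [lintegral_indicator measurableSet_Ioo, setLIntegral_const, Real.volume_Ioo, sub_zero,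
      mul_comm, ENNReal.ofReal_mul (hψ.nonneg 1)]
  calc _ ≤ ∫⁻ p in hookRegion ψ, (f p + g p) := by
        refine setLIntegral_mono (mf.add mg) fun p hp => ?_
        by_cases hx : p.1 ≤ 1
        · refine le_trans ?_ le_self_add
          simp only [f, Set.indicator_of_mem (show p.1 ∈ Set.Ioc 0 1 from ⟨hp.1, hx⟩)]
          exact ofReal_log_max_sub_le (sub_pos.2 hp.2.2).le (hψ.vertical_le_hookLength hp)
        · refine le_trans ?_ le_add_self
          have hy : p.2 ∈ Set.Ioo 0 (ψ 1) :=
            ⟨hp.2.1, hp.2.2.trans_le (hψ.antitone (not_le.1 hx).le)⟩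
          simp only [g, Set.indicator_of_mem hy]
          exact ofReal_log_max_sub_le (sub_nonneg.2 (hψ.le_phiInv hp.2.1 hp.2.2))
            (horizontal_le_hookLength hp)
    _ ≤ ∫⁻ p, (f p + g p) := setLIntegral_le_lintegral _ _
    _ = _ := by
        rw [lintegral_add_left mf, If, Ig, ← ENNReal.ofReal_add hδ.le
          (mul_nonneg (hψ.nonneg 1) hδ.le)]
        congr 1; ring

end LogSingularity

section Truncation

variable {ψ : ℝ → ℝ} {δ : ℝ}

lemma IsShape.log_max_sub_nonneg (hψ : IsShape ψ) {p : ℝ × ℝ} (hp : p ∈ hookRegion ψ) (δ : ℝ) :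
    0 ≤ Real.log (max (hookLength ψ p) δ) - Real.log (hookLength ψ p) :=
  sub_nonneg.2 (Real.log_le_log (hψ.hookLength_pos hp) (le_max_left _ _))

lemma IsShape.integrableOn_log_max_sub (hψ : IsShape ψ) (hδ : 0 < δ) :
    IntegrableOn (fun p => Real.log (max (hookLength ψ p) δ) - Real.log (hookLength ψ p))
      (hookRegion ψ) := by
  have m := hψ.measurable_hookLength
  refine ⟨(by fun_prop : Measurable _).aestronglyMeasurable, ?_⟩
  rw [hasFiniteIntegral_iff_ofReal]
  · exact (hψ.lintegral_log_max_sub_le hδ).trans_lt ENNReal.ofReal_lt_top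
  · filter_upwards [ae_restrict_mem hψ.measurableSet_hookRegion] with p hp
    exact hψ.log_max_sub_nonneg hp δ

lemma IsShape.abs_integral_log_max_sub_le (hψ : IsShape ψ) (hδ : 0 < δ)
    (hint : IntegrableOn (fun p => Real.log (max (hookLength ψ p) δ)) (hookRegion ψ)) :
    |(∫ p in hookRegion ψ, Real.log (max (hookLength ψ p) δ))
      - ∫ p in hookRegion ψ, Real.log (hookLength ψ p)| ≤ (1 + ψ 1) * δ := by
  have hE := hψ.integrableOn_log_max_sub hδ
  have hlog : IntegrableOn (fun p => Real.log (hookLength ψ p)) (hookRegion ψ) := by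
    refine (hint.sub hE).congr (Eventually.of_forall fun p => ?_)
    simp
  have hae : 0 ≤ᵐ[volume.restrict (hookRegion ψ)]
      fun p => Real.log (max (hookLength ψ p) δ) - Real.log (hookLength ψ p) := by
    filter_upwards [ae_restrict_mem hψ.measurableSet_hookRegion] with p hp
    exact hψ.log_max_sub_nonneg hp δ
  have h0 : 0 ≤ (1 + ψ 1) * δ := mul_nonneg (add_nonneg zero_le_one (hψ.nonneg 1)) hδ.le
  rw [← integral_sub hint hlog, abs_of_nonneg (integral_nonneg_of_ae hae),
    integral_eq_lintegral_of_nonneg_ae hae hE.aestronglyMeasurable]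
  exact ENNReal.toReal_le_of_le_ofReal h0 (hψ.lintegral_log_max_sub_le hδ)

end Truncation

section Convergence

variable {φ : ℝ → ℝ} {φs : ℕ → ℝ → ℝ}

lemma tendsto_phiInv (hs : ∀ n, IsShape (φs n))
    (hae : ∀ᵐ x, 0 < x → Tendsto (fun n => φs n x) atTop (𝓝 (φ x))) (hφ : Antitone φ) {y : ℝ}
    (hy : 0 < y) (hne : ∀ z, 0 < z → ∃ x, 0 ≤ x ∧ φ x ≤ z) (hc : ContinuousAt (phiInv φ) y) :
    Tendsto (fun n => phiInv (φs n) y) atTop (𝓝 (phiInv φ y)) := by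
  have hdense := Measure.dense_of_ae hae
  refine tendsto_order.2 ⟨fun a ha => ?_, fun b hb => ?_⟩
  · rcases lt_or_ge a 0 with ha0 | ha0
    · exact Eventually.of_forall fun n => ha0.trans_le (phiInv_nonneg _ _)
    obtain ⟨z, hyz, hz⟩ : ∃ z, y < z ∧ a < phiInv φ z := by
      have h1 : ∀ᶠ z in 𝓝[>] y, a < phiInv φ z :=
        (hc.tendsto.mono_left nhdsWithin_le_nhds).eventually_const_lt ha
      obtain ⟨z, h, h'⟩ := (h1.and self_mem_nhdsWithin).exists
      exact ⟨z, h', h⟩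
    obtain ⟨x, hx, hax, hxz⟩ := hdense.exists_between hz
    have hx0 : 0 < x := ha0.trans_lt hax
    have := hyz.trans (lt_of_lt_phiInv hx0.le hxz)
    filter_upwards [(hx hx0).eventually_const_lt this] with n hn
    exact hax.trans_le ((hs n).le_phiInv hy hn)
  · obtain ⟨z, hz0, hyz, hz⟩ : ∃ z, 0 < z ∧ z < y ∧ phiInv φ z < b := by
      have h1 : ∀ᶠ z in 𝓝[<] y, phiInv φ z < b :=
        (hc.tendsto.mono_left nhdsWithin_le_nhds).eventually_lt_const hb
      have h2 : ∀ᶠ z in 𝓝[<] y, 0 < z := nhdsWithin_le_nhds (lt_mem_nhds hy)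
      obtain ⟨z, ⟨h, h'⟩, h''⟩ := ((h1.and h2).and self_mem_nhdsWithin).exists
      exact ⟨z, h', h'', h⟩
    obtain ⟨x', hx', hx'b⟩ := exists_lt_of_csInf_lt (hne z hz0) hz
    obtain ⟨x, hx, hx'x, hxb⟩ := hdense.exists_between hx'b
    have hx0 : 0 < x := hx'.1.trans_lt hx'x
    have := ((hφ hx'x.le).trans hx'.2).trans_lt hyz
    filter_upwards [(hx hx0).eventually_lt_const this] with n hn
    exact (phiInv_le hx0.le hn.le).trans_lt hxb

lemma ae_snd_ne (hφ : Measurable φ) : ∀ᵐ p : ℝ × ℝ, p.2 ≠ φ p.1 := by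
  have hm : MeasurableSet {p : ℝ × ℝ | p.2 = φ p.1} :=
    measurableSet_eq_fun measurable_snd (hφ.comp measurable_fst)
  rw [ae_iff]
  simp only [ne_eq, not_not]
  rw [Measure.volume_eq_prod, Measure.measure_prod_null hm]
  refine Eventually.of_forall fun x => ?_
  have : Prod.mk x ⁻¹' {p : ℝ × ℝ | p.2 = φ p.1} = {φ x} := by ext; simp
  simp [this]

lemma IsShape.ae_continuousAt_phiInv (hφ : IsShape φ) :
    ∀ᵐ y, 0 < y → ContinuousAt (phiInv φ) y := by
  have h := hφ.antitoneOn_phiInv.countable_not_continuousWithinAt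
  filter_upwards [h.ae_notMem volume] with y hy hy0
  by_contra hc
  exact hy ⟨hy0, fun hw => hc (hw.continuousAt (Ioi_mem_nhds hy0))⟩

lemma ae_tendsto_indicator_log_max (hφ : IsShape φ) (hs : ∀ n, IsShape (φs n))
    (hae : ∀ᵐ x, 0 < x → Tendsto (fun n => φs n x) atTop (𝓝 (φ x))) {δ : ℝ} (hδ : 0 < δ) :
    ∀ᵐ p : ℝ × ℝ, Tendsto
      (fun n => (hookRegion (φs n)).indicator (fun q => Real.log (max (hookLength (φs n) q) δ)) p)
      atTop (𝓝 ((hookRegion φ).indicator (fun q => Real.log (max (hookLength φ q) δ)) p)) := by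
  have h1 : ∀ᵐ p : ℝ × ℝ, 0 < p.1 → Tendsto (fun n => φs n p.1) atTop (𝓝 (φ p.1)) :=
    Measure.quasiMeasurePreserving_fst.ae hae
  have h2 : ∀ᵐ p : ℝ × ℝ, 0 < p.2 → ContinuousAt (phiInv φ) p.2 :=
    Measure.quasiMeasurePreserving_snd.ae hφ.ae_continuousAt_phiInv
  filter_upwards [h1, h2, ae_snd_ne hφ.antitone.measurable] with p hp1 hp2 hne
  by_cases hpos : 0 < p.1 ∧ 0 < p.2
  · have hx := hp1 hpos.1
    have hy := tendsto_phiInv hs hae hφ.antitone hpos.2 hφ.decay (hp2 hpos.2)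
    rcases hne.lt_or_gt with h | h
    · have hmem : p ∈ hookRegion φ := ⟨hpos.1, hpos.2, h⟩
      rw [Set.indicator_of_mem hmem]
      have hlim : Tendsto (fun n => Real.log (max (hookLength (φs n) p) δ)) atTop
          (𝓝 (Real.log (max (hookLength φ p) δ))) := by
        have : Tendsto (fun n => hookLength (φs n) p) atTop (𝓝 (hookLength φ p)) :=
          ((hx.add hy).sub_const _).sub_const _
        exact (this.max tendsto_const_nhds).log (hδ.trans_le (le_max_right _ _)).ne'
      refine hlim.congr' ?_
      filter_upwards [hx.eventually_const_lt h] with n hn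
      rw [Set.indicator_of_mem (show p ∈ hookRegion (φs n) from ⟨hpos.1, hpos.2, hn⟩)]
    · rw [Set.indicator_of_notMem (fun hm : p ∈ hookRegion φ => hm.2.2.not_gt h)]
      refine tendsto_const_nhds.congr' ?_
      filter_upwards [hx.eventually_lt_const h] with n hn
      rw [Set.indicator_of_notMem (fun hm : p ∈ hookRegion (φs n) => hm.2.2.not_gt hn)]
  · have : ∀ ψ : ℝ → ℝ, p ∉ hookRegion ψ := fun ψ hm => hpos ⟨hm.1, hm.2.1⟩
    simp [this]

end Convergence

section Domination

variable {φ : ℝ → ℝ} {φs : ℕ → ℝ → ℝ} {M : ℝ}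

lemma abs_log_max_le {δ h U : ℝ} (hδ : 0 < δ) (hδ1 : δ ≤ 1) (hU : 1 ≤ U) (hh : h ≤ U) :
    |Real.log (max h δ)| ≤ -Real.log δ + Real.log U := by
  have h1 : Real.log δ ≤ 0 := Real.log_nonpos hδ.le hδ1
  have h2 : 0 ≤ Real.log U := Real.log_nonneg hU
  have h3 : Real.log δ ≤ Real.log (max h δ) := Real.log_le_log hδ (le_max_right _ _)
  have h4 : Real.log (max h δ) ≤ Real.log U :=
    Real.log_le_log (hδ.trans_le (le_max_right _ _)) (max_le hh (hδ1.trans hU))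
  exact abs_le.2 ⟨by linarith, by linarith⟩

lemma log_add_le {K h : ℝ} (hK : 1 ≤ K) (hh : 0 < h) :
    Real.log (K + h) ≤ Real.log (2 * K) + |Real.log h| := by
  rcases le_total h 1 with h1 | h1
  · have := Real.log_le_log (by linarith) (show K + h ≤ 2 * K by linarith)
    linarith [abs_nonneg (Real.log h)]
  · have := Real.log_le_log (by linarith) (show K + h ≤ 2 * K * h by nlinarith)
    rw [Real.log_mul (by linarith) hh.ne'] at this
    linarith [le_abs_self (Real.log h)]

lemma log_add_inv_le {K y : ℝ} (hK : 0 < K) (hy : 0 < y) (hyM : y ≤ M) :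
    Real.log (K + y⁻¹) ≤ Real.log (K * M + 1) - Real.log y := by
  have h1 : K + y⁻¹ = (K * y + 1) / y := by field_simp
  have h2 : 0 < K * y := mul_pos hK hy
  rw [h1, Real.log_div (by positivity) hy.ne']
  gcongr

lemma phiInv_le_inv (hxφ : ∀ x, 0 < x → x * φ x ≤ 1) {y : ℝ} (hy : 0 < y) :
    phiInv φ y ≤ y⁻¹ := by
  refine phiInv_le (by positivity) ?_
  have := hxφ y⁻¹ (by positivity)
  rwa [inv_mul_le_iff₀ hy, mul_one] at this

lemma IsShape.phiInv_le_add_two (hφ : IsShape φ) {ψ : ℝ → ℝ} (hle : ∀ x, 2 < x → ψ x ≤ φ x)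
    {y : ℝ} (hy : 0 < y) : phiInv ψ y ≤ 2 + phiInv φ y := by
  refine le_of_forall_pos_le_add fun ε hε => ?_
  obtain ⟨x, hx, hxε⟩ := exists_lt_of_csInf_lt (hφ.decay y hy) (lt_add_of_pos_right (phiInv φ y) hε)
  have h1 : ψ (2 + phiInv φ y + ε) ≤ y := by
    have h0 := phiInv_nonneg φ y
    exact (hle _ (by linarith)).trans ((hφ.antitone (by unfold phiInv at *; linarith)).trans hx.2)
  exact phiInv_le (by have := phiInv_nonneg φ y; linarith) h1

/-- A common dominating function for the truncated logarithms of the hook lengths of shapes which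
are bounded by `M` and lie below `φ` outside `(0, 2]`. -/
noncomputable def hookBound (φ : ℝ → ℝ) (M δ : ℝ) (p : ℝ × ℝ) : ℝ :=
  (hookRegion φ).indicator
      (fun q => -Real.log δ + Real.log (2 * (M + 3)) + |Real.log (hookLength φ q)|) p +
    (Set.Ioc 0 2 ×ˢ Set.Ioc 0 M).indicator
      (fun q => -Real.log δ + Real.log ((M + 3) * M + 1) + |Real.log q.2|) p

lemma IsShape.integrable_hookBound (hφ : IsShape φ) (hvol : volume (hookRegion φ) ≠ ⊤)
    (hfin : IntegrableOn (fun p => Real.log (hookLength φ p)) (hookRegion φ)) (M δ : ℝ) :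
    Integrable (hookBound φ M δ) := by
  refine Integrable.add ?_ ?_
  · rw [integrable_indicator_iff hφ.measurableSet_hookRegion]
    exact (integrableOn_const hvol).add hfin.abs
  · rw [integrable_indicator_iff (measurableSet_Ioc.prod measurableSet_Ioc)]
    rw [IntegrableOn, Measure.volume_eq_prod, ← Measure.prod_restrict]
    have h1 : IntegrableOn Real.log (Set.Ioc 0 M) :=
      (intervalIntegral.intervalIntegrable_log' (a := 0) (b := M)).1
    exact (integrable_const _).add (h1.abs.comp_snd _)

lemma IsShape.norm_indicator_le_hookBound (hφ : IsShape φ) {ψ : ℝ → ℝ} (hψM : ∀ x, ψ x ≤ M)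
    (hM : 0 ≤ M) (hle : ∀ x, 2 < x → ψ x ≤ φ x) (hxφ : ∀ x, 0 < x → x * φ x ≤ 1) {δ : ℝ}
    (hδ : 0 < δ) (hδ1 : δ ≤ 1) (p : ℝ × ℝ) :
    ‖(hookRegion ψ).indicator (fun q => Real.log (max (hookLength ψ q) δ)) p‖
      ≤ hookBound φ M δ p := by
  have hlδ : Real.log δ ≤ 0 := Real.log_nonpos hδ.le hδ1
  have n1 : 0 ≤ (hookRegion φ).indicator
      (fun q => -Real.log δ + Real.log (2 * (M + 3)) + |Real.log (hookLength φ q)|) p := by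
    refine Set.indicator_nonneg (fun q _ => ?_) p
    have := Real.log_nonneg (show 1 ≤ 2 * (M + 3) by linarith)
    have := abs_nonneg (Real.log (hookLength φ q))
    linarith
  have n2 : 0 ≤ (Set.Ioc 0 2 ×ˢ Set.Ioc 0 M).indicator
      (fun q : ℝ × ℝ => -Real.log δ + Real.log ((M + 3) * M + 1) + |Real.log q.2|) p := by
    refine Set.indicator_nonneg (fun q _ => ?_) p
    have := Real.log_nonneg (show 1 ≤ (M + 3) * M + 1 by nlinarith)
    have := abs_nonneg (Real.log q.2)
    linarith
  unfold hookBound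
  by_cases hp : p ∈ hookRegion ψ
  swap
  · rw [Set.indicator_of_notMem hp, norm_zero]
    exact add_nonneg n1 n2
  rw [Set.indicator_of_mem hp, Real.norm_eq_abs]
  obtain ⟨hx, hy, hyx⟩ := id hp
  have hinv := hφ.phiInv_le_add_two hle hy
  have hb := hψM p.1
  have h0 := phiInv_nonneg φ p.2
  have hlen : hookLength ψ p ≤ M + 3 + (phiInv φ p.2 - p.1) := by
    unfold hookLength
    linarith
  rcases le_or_gt p.1 2 with h2 | h2
  · refine le_trans ?_ (le_add_of_nonneg_left n1)
    have hyM : p.2 ≤ M := hyx.le.trans hb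
    rw [Set.indicator_of_mem (show p ∈ Set.Ioc 0 2 ×ˢ Set.Ioc 0 M from ⟨⟨hx, h2⟩, hy, hyM⟩)]
    have hi := phiInv_le_inv hxφ hy
    refine (abs_log_max_le (U := M + 3 + p.2⁻¹) hδ hδ1 (by linarith) (by linarith)).trans ?_
    have := log_add_inv_le (K := M + 3) (by linarith) hy hyM
    have := neg_le_abs (Real.log p.2)
    linarith
  · refine le_trans ?_ (le_add_of_nonneg_right n2)
    have hp' : p ∈ hookRegion φ := ⟨hx, hy, hyx.trans_le (hle _ h2)⟩
    rw [Set.indicator_of_mem hp']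
    have hpos := hφ.hookLength_pos hp'
    have := horizontal_le_hookLength hp'
    refine (abs_log_max_le (U := M + 3 + hookLength φ p) hδ hδ1 (by linarith)
      (by linarith)).trans ?_
    have := log_add_le (K := M + 3) (by linarith) hpos
    linarith

/-- Continuity of the hook integral along a.e. convergent sequences of uniformly bounded shapes
lying below the limit shape outside `(0, 2]`. -/
theorem IsShape.tendsto_integral_log_hookLength (hφ : IsShape φ) (hs : ∀ n, IsShape (φs n))
    (hM : ∀ n x, φs n x ≤ M) (hle : ∀ n x, 2 < x → φs n x ≤ φ x)
    (hxφ : ∀ x, 0 < x → x * φ x ≤ 1) (hvol : volume (hookRegion φ) ≠ ⊤)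
    (hfin : IntegrableOn (fun p => Real.log (hookLength φ p)) (hookRegion φ))
    (hae : ∀ᵐ x, 0 < x → Tendsto (fun n => φs n x) atTop (𝓝 (φ x))) :
    Tendsto (fun n => ∫ p in hookRegion (φs n), Real.log (hookLength (φs n) p)) atTop
      (𝓝 (∫ p in hookRegion φ, Real.log (hookLength φ p))) := by
  have hM0 : 0 ≤ M := ((hs 0).nonneg 0).trans (hM 0 0)
  have hφ1 := hφ.nonneg 1
  have hC : 0 < 1 + M + φ 1 := by linarith
  rw [Metric.tendsto_atTop]
  intro ε hε
  obtain ⟨δ, hδ, hδ1, hδε⟩ : ∃ δ, 0 < δ ∧ δ ≤ 1 ∧ (1 + M + φ 1) * δ ≤ ε / 3 := by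
    refine ⟨min 1 (ε / 3 / (1 + M + φ 1)), by positivity, min_le_left _ _, ?_⟩
    rw [← le_div_iff₀' hC]
    exact min_le_right _ _
  have hmeas : ∀ ψ, IsShape ψ → Measurable
      ((hookRegion ψ).indicator (fun q => Real.log (max (hookLength ψ q) δ))) := fun ψ hψ =>
    Measurable.indicator (by have := hψ.measurable_hookLength; fun_prop) hψ.measurableSet_hookRegion
  have hG := hφ.integrable_hookBound hvol hfin M δ
  have hbd := fun n => hφ.norm_indicator_le_hookBound (hM n) hM0 (hle n) hxφ hδ hδ1
  have hlim := tendsto_integral_of_dominated_convergence (hookBound φ M δ)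
    (fun n => (hmeas _ (hs n)).aestronglyMeasurable) hG
    (fun n => Eventually.of_forall (hbd n)) (ae_tendsto_indicator_log_max hφ hs hae hδ)
  simp only [integral_indicator, hφ.measurableSet_hookRegion, (hs _).measurableSet_hookRegion]
    at hlim
  have hintn : ∀ n, IntegrableOn (fun q => Real.log (max (hookLength (φs n) q) δ))
      (hookRegion (φs n)) := fun n => by
    rw [← integrable_indicator_iff (hs n).measurableSet_hookRegion]
    exact hG.mono' (hmeas _ (hs n)).aestronglyMeasurable (Eventually.of_forall (hbd n))
  have hint : IntegrableOn (fun q => Real.log (max (hookLength φ q) δ)) (hookRegion φ) := by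
    refine ((hφ.integrableOn_log_max_sub hδ).add hfin).congr (Eventually.of_forall fun p => ?_)
    simp
  obtain ⟨N, hN⟩ := Metric.tendsto_atTop.1 hlim (ε / 3) (by positivity)
  refine ⟨N, fun n hn => ?_⟩
  have e1 := abs_le.1 ((hs n).abs_integral_log_max_sub_le hδ (hintn n))
  have e2 := abs_le.1 (hφ.abs_integral_log_max_sub_le hδ hint)
  have e3 := abs_lt.1 (hN n hn)
  have b1 : (1 + φs n 1) * δ ≤ (1 + M + φ 1) * δ :=
    mul_le_mul_of_nonneg_right (by linarith [hM n 1]) hδ.le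
  have b2 : (1 + φ 1) * δ ≤ (1 + M + φ 1) * δ := by gcongr; linarith
  rw [Real.dist_eq, abs_lt]
  constructor <;> linarith [e1.1, e1.2, e2.1, e2.2, e3.1, e3.2]

end Domination

section RescaledShape

lemma phiOf_zero_left (l : ℕ → ℕ) (x : ℝ) : phiOf 0 l x = 0 := by simp [phiOf]

lemma phiOf_nonneg (n : ℕ) (l : ℕ → ℕ) (x : ℝ) : 0 ≤ phiOf n l x := by
  unfold phiOf
  positivity

lemma phiOf_add (n : ℕ) (l m : ℕ → ℕ) (x : ℝ) :
    phiOf n (fun i => l i + m i) x = phiOf n l x + phiOf n m x := by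
  simp [phiOf, add_div]

lemma antitone_phiOf (n : ℕ) {l : ℕ → ℕ} (hl : Antitone l) : Antitone (phiOf n l) := by
  intro x y hxy
  unfold phiOf
  gcongr
  exact hl (Nat.floor_le_floor (by gcongr))

lemma isShape_phiOf (n : ℕ) {l : ℕ → ℕ} (hl : Antitone l) {N : ℕ} (hN : ∀ i ≥ N, l i = 0) :
    IsShape (phiOf n l) where
  antitone := antitone_phiOf n hl
  nonneg := phiOf_nonneg n l
  decay y hy := by
    rcases n.eq_zero_or_pos with rfl | hn
    · exact ⟨0, le_rfl, by rw [phiOf_zero_left]; exact hy.le⟩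
    · have hs : 0 < √(n : ℝ) := Real.sqrt_pos.2 (by exact_mod_cast hn)
      refine ⟨N / √n, by positivity, ?_⟩
      simp [phiOf, div_mul_cancel₀ _ hs.ne', hN N le_rfl, hy.le]

lemma integral_phiOf {n : ℕ} (hn : 0 < n) {l : ℕ → ℕ} {N : ℕ} (hN : ∀ i ≥ N, l i = 0) :
    ∫ x in Set.Ioi (0 : ℝ), phiOf n l x = (∑ i ∈ Finset.range N, (l i : ℝ)) / n := by
  have hs : 0 < √(n : ℝ) := Real.sqrt_pos.2 (by exact_mod_cast hn)
  have key : ∀ x ∈ Set.Ici (0 : ℝ), phiOf n l x = ∑ i ∈ Finset.range N,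
      (Set.Ico (i / √n) ((i + 1) / √n)).indicator (fun _ => l i / √(n : ℝ)) x := by
    intro x hx
    have hx : 0 ≤ x := hx
    have h1 : ∀ i : ℕ, (Set.Ico (i / √(n : ℝ)) ((i + 1) / √n)).indicator
        (fun _ => l i / √(n : ℝ)) x = if ⌊x * √n⌋₊ = i then l i / √(n : ℝ) else 0 := by
      intro i
      rw [Set.indicator_apply]
      congr 1
      rw [Set.mem_Ico, div_le_iff₀ hs, lt_div_iff₀ hs, Nat.floor_eq_iff (by positivity)]
    simp_rw [h1]
    rw [Finset.sum_ite_eq]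
    split_ifs with h
    · rfl
    · simp [phiOf, hN _ (not_lt.1 fun h' => h (Finset.mem_range.2 h'))]
  rw [← integral_Ici_eq_integral_Ioi, setIntegral_congr_fun measurableSet_Ici key,
    integral_finsetSum, Finset.sum_div]
  · refine Finset.sum_congr rfl fun i _ => ?_
    have hsub : Set.Ico (i / √(n : ℝ)) ((i + 1) / √n) ⊆ Set.Ici 0 := fun x hx =>
      (by positivity : (0 : ℝ) ≤ i / √n).trans hx.1
    rw [setIntegral_indicator measurableSet_Ico, Set.inter_eq_right.2 hsub, setIntegral_const,
      Real.volume_real_Ico_of_le (by gcongr; linarith), smul_eq_mul]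
    field_simp
    rw [Real.sq_sqrt (by positivity)]
    ring
  · intro i _
    refine Integrable.integrableOn ?_
    rw [integrable_indicator_iff measurableSet_Ico]
    exact integrableOn_const (by simp)

end RescaledShape

section EvenParts

/-- `d` distributed over `k` parts as evenly as possible. -/
def evenParts (k d i : ℕ) : ℕ := if i < k then d / k + if i < d % k then 1 else 0 else 0

lemma antitone_evenParts (k d : ℕ) : Antitone (evenParts k d) := by
  intro i j hij
  unfold evenParts
  generalize d / k = q
  split_ifs <;> omega

lemma evenParts_eq_zero {k d i : ℕ} (h : k ≤ i) : evenParts k d i = 0 := by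
  simp [evenParts, h.not_gt]

lemma evenParts_le (k d i : ℕ) : evenParts k d i ≤ d / k + 1 := by
  unfold evenParts
  generalize d / k = q
  split_ifs <;> omega

lemma sum_evenParts {k : ℕ} (hk : 0 < k) (d : ℕ) : ∑ i ∈ Finset.range k, evenParts k d i = d := by
  have h : ∀ i ∈ Finset.range k, evenParts k d i = d / k + if i < d % k then 1 else 0 :=
    fun i hi => if_pos (Finset.mem_range.1 hi)
  have h2 : (Finset.range k).filter (· < d % k) = Finset.range (d % k) := by
    ext i
    have := Nat.mod_lt d hk
    simp only [Finset.mem_filter, Finset.mem_range]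
    omega
  rw [Finset.sum_congr rfl h, Finset.sum_add_distrib, ← Finset.card_filter, h2]
  simp [Nat.div_add_mod]

lemma phiOf_evenParts_le (n d : ℕ) (x : ℝ) :
    phiOf n (evenParts (n.sqrt + 1) d) x ≤ d / n + 1 / √n := by
  rcases n.eq_zero_or_pos with rfl | hn
  · simp [phiOf]
  have hs : 0 < √(n : ℝ) := Real.sqrt_pos.2 (by exact_mod_cast hn)
  have hk : √(n : ℝ) ≤ ((n.sqrt + 1 : ℕ) : ℝ) := by
    rw [Real.sqrt_le_left (by positivity)]
    exact_mod_cast (Nat.lt_succ_sqrt' n).le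
  have h1 : ((d / (n.sqrt + 1) : ℕ) : ℝ) ≤ d / √n :=
    Nat.cast_div_le.trans (by gcongr)
  have h2 : (evenParts (n.sqrt + 1) d ⌊x * √n⌋₊ : ℝ) ≤ d / √n + 1 := by
    have : (evenParts (n.sqrt + 1) d ⌊x * √n⌋₊ : ℝ) ≤ (d / (n.sqrt + 1) : ℕ) + 1 := by
      exact_mod_cast evenParts_le _ _ _
    linarith
  calc phiOf n (evenParts (n.sqrt + 1) d) x ≤ (d / √n + 1) / √n := by
        unfold phiOf
        gcongr
    _ = d / n + 1 / √n := by rw [add_div, div_div, Real.mul_self_sqrt (by positivity)]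

lemma phiOf_evenParts_eq_zero (n d : ℕ) {x : ℝ} (hx : 2 < x) :
    phiOf n (evenParts (n.sqrt + 1) d) x = 0 := by
  rcases n.eq_zero_or_pos with rfl | hn
  · exact phiOf_zero_left _ _
  have h1 : 1 ≤ √(n : ℝ) := Real.one_le_sqrt.2 (by exact_mod_cast hn)
  have h2 : (n.sqrt : ℝ) ≤ √n := Real.nat_sqrt_le_real_sqrt
  rw [phiOf, evenParts_eq_zero (Nat.le_floor ?_)]
  · simp
  · push_cast
    nlinarith

end EvenParts

section LowerParts

variable {φ : ℝ → ℝ}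

/-- The parts of the largest partition whose shape, rescaled by `√n`, lies below `φ`. -/
noncomputable def lowerParts (φ : ℝ → ℝ) (n i : ℕ) : ℕ := ⌊√(n : ℝ) * φ ((i + 1) / √n)⌋₊

lemma antitone_lowerParts (hφ : Antitone φ) (n : ℕ) : Antitone (lowerParts φ n) := by
  intro i j hij
  unfold lowerParts
  refine Nat.floor_le_floor (mul_le_mul_of_nonneg_left (hφ ?_) (Real.sqrt_nonneg _))
  gcongr

lemma lowerParts_eq_zero (hxφ : ∀ x, 0 < x → x * φ x ≤ 1) {n i : ℕ} (h : n ≤ i) :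
    lowerParts φ n i = 0 := by
  rcases n.eq_zero_or_pos with rfl | hn
  · simp [lowerParts]
  have hs : 0 < √(n : ℝ) := Real.sqrt_pos.2 (by exact_mod_cast hn)
  have h1 := hxφ ((i + 1) / √n) (by positivity)
  have h2 : (n : ℝ) ≤ i := by exact_mod_cast h
  have h3 : √(n : ℝ) * √n = n := Real.mul_self_sqrt (by positivity)
  rw [lowerParts, Nat.floor_eq_zero]
  by_contra! hc
  have h4 : ((i + 1) / √n) * φ ((i + 1) / √n) * (√n * √n)
      = (i + 1) * (√(n : ℝ) * φ ((i + 1) / √n)) := by field_simp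
  rw [h3] at h4
  nlinarith

lemma phiOf_lowerParts_le (hφ : Antitone φ) (h0 : ∀ x, 0 ≤ φ x) (n : ℕ) (x : ℝ) :
    phiOf n (lowerParts φ n) x ≤ φ (max x 0) := by
  rcases n.eq_zero_or_pos with rfl | hn
  · rw [phiOf_zero_left]
    exact h0 _
  have hs : 0 < √(n : ℝ) := Real.sqrt_pos.2 (by exact_mod_cast hn)
  rw [phiOf, div_le_iff₀ hs, lowerParts]
  refine (Nat.floor_le (mul_nonneg hs.le (h0 _))).trans ?_
  rw [mul_comm]
  refine mul_le_mul_of_nonneg_right (hφ (max_le ?_ (by positivity))) hs.le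
  rw [le_div_iff₀ hs]
  exact (Nat.lt_floor_add_one _).le

lemma tendsto_sqrt_natCast : Tendsto (fun n : ℕ => √(n : ℝ)) atTop atTop :=
  Real.tendsto_sqrt_atTop.comp tendsto_natCast_atTop_atTop

lemma tendsto_phiOf_lowerParts (h0 : ∀ x, 0 ≤ φ x) {x : ℝ} (hx : 0 < x)
    (hc : ContinuousAt φ x) :
    Tendsto (fun n => phiOf n (lowerParts φ n) x) atTop (𝓝 (φ x)) := by
  have hinv : Tendsto (fun n : ℕ => 1 / √(n : ℝ)) atTop (𝓝 0) :=
    tendsto_const_nhds.div_atTop tendsto_sqrt_natCast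
  have hx' : Tendsto (fun n : ℕ => ((⌊x * √(n : ℝ)⌋₊ : ℝ) + 1) / √n) atTop (𝓝 x) := by
    have := ((tendsto_nat_floor_mul_div_atTop hx.le).comp tendsto_sqrt_natCast).add hinv
    simpa [add_div] using this
  have hφ' := hc.tendsto.comp hx'
  refine tendsto_of_tendsto_of_tendsto_of_le_of_le' (by simpa using hφ'.sub hinv) hφ' ?_ ?_
  · filter_upwards [eventually_gt_atTop 0] with n hn
    have hs : 0 < √(n : ℝ) := Real.sqrt_pos.2 (by exact_mod_cast hn)
    simp only [phiOf, lowerParts]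
    rw [le_div_iff₀ hs, sub_mul, inv_mul_cancel₀ hs.ne', mul_comm]
    exact (Nat.sub_one_lt_floor _).le
  · filter_upwards [eventually_gt_atTop 0] with n hn
    have hs : 0 < √(n : ℝ) := Real.sqrt_pos.2 (by exact_mod_cast hn)
    simp only [phiOf, lowerParts]
    rw [div_le_iff₀ hs]
    exact (Nat.floor_le (mul_nonneg hs.le (h0 _))).trans_eq (mul_comm _ _)

end LowerParts

section Approximation

variable {φ : ℝ → ℝ}

lemma mul_le_integral_of_antitone (hφ : Antitone φ) (h0 : ∀ x, 0 ≤ φ x)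
    (hi : IntegrableOn φ (Set.Ioi 0)) {x : ℝ} (hx : 0 < x) :
    x * φ x ≤ ∫ t in Set.Ioi (0 : ℝ), φ t := by
  calc x * φ x = ∫ _ in Set.Ioc 0 x, φ x := by simp [hx.le]
    _ ≤ ∫ t in Set.Ioc 0 x, φ t :=
        setIntegral_mono_on (integrableOn_const (by simp)) (hi.mono_set Set.Ioc_subset_Ioi_self)
          measurableSet_Ioc fun t ht => hφ ht.2
    _ ≤ _ := setIntegral_mono_set hi (Eventually.of_forall h0)
        Set.Ioc_subset_Ioi_self.eventuallyLE

lemma volume_hookRegion_ne_top (hφ : Antitone φ) (hi : IntegrableOn φ (Set.Ioi 0)) :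
    volume (hookRegion φ) ≠ ⊤ := by
  have h : hookRegion φ = regionBetween (fun _ => 0) φ (Set.Ioi 0) := by
    ext p
    simp [hookRegion, regionBetween]
  rw [h, Measure.volume_eq_prod, volume_regionBetween_eq_lintegral measurable_const.aemeasurable
    hφ.measurable.aemeasurable measurableSet_Ioi]
  simpa using hi.lintegral_lt_top.ne

/-- The number of cells missing from the lower partition of `φ` to reach `n`. -/
noncomputable def missingCells (φ : ℝ → ℝ) (n : ℕ) : ℕ :=
  n - ∑ i ∈ Finset.range n, lowerParts φ n i

/-- A partition of `n` approximating `φ`: the lower partition, with the missing cells spread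
evenly over the first `⌊√n⌋ + 1` parts. -/
noncomputable def approxParts (φ : ℝ → ℝ) (n i : ℕ) : ℕ :=
  lowerParts φ n i + evenParts (n.sqrt + 1) (missingCells φ n) i

lemma phiOf_approxParts (n : ℕ) (x : ℝ) : phiOf n (approxParts φ n) x =
    phiOf n (lowerParts φ n) x + phiOf n (evenParts (n.sqrt + 1) (missingCells φ n)) x :=
  phiOf_add n _ _ x

lemma antitone_approxParts (hφ : Antitone φ) (n : ℕ) : Antitone (approxParts φ n) :=
  (antitone_lowerParts hφ n).add (antitone_evenParts _ _)

lemma approxParts_eq_zero (hxφ : ∀ x, 0 < x → x * φ x ≤ 1) {n i : ℕ} (hi : n + n.sqrt + 1 ≤ i) :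
    approxParts φ n i = 0 := by
  rw [approxParts, lowerParts_eq_zero hxφ (by omega), evenParts_eq_zero (by omega)]

lemma phiOf_evenParts_missingCells_le_two (n : ℕ) (x : ℝ) :
    phiOf n (evenParts (n.sqrt + 1) (missingCells φ n)) x ≤ 2 := by
  rcases n.eq_zero_or_pos with rfl | hn
  · rw [phiOf_zero_left]
    norm_num
  have hn' : (0 : ℝ) < n := by exact_mod_cast hn
  have h1 : (missingCells φ n : ℝ) / n ≤ 1 := by
    rw [div_le_one hn']
    exact_mod_cast Nat.sub_le _ _
  have h2 : 1 / √(n : ℝ) ≤ 1 := by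
    rw [div_le_one (Real.sqrt_pos.2 hn')]
    exact Real.one_le_sqrt.2 (by exact_mod_cast hn)
  linarith [phiOf_evenParts_le n (missingCells φ n) x]

lemma phiOf_lowerParts_le_self (hφ : Antitone φ) (h0 : ∀ x, 0 ≤ φ x) (n : ℕ) (x : ℝ) :
    phiOf n (lowerParts φ n) x ≤ φ x :=
  (phiOf_lowerParts_le hφ h0 n x).trans (hφ (le_max_left _ _))

lemma sum_lowerParts_le (hφ : Antitone φ) (h0 : ∀ x, 0 ≤ φ x) (hi : IntegrableOn φ (Set.Ioi 0))
    (h1 : ∫ x in Set.Ioi (0 : ℝ), φ x = 1) (hxφ : ∀ x, 0 < x → x * φ x ≤ 1) (n : ℕ) :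
    ∑ i ∈ Finset.range n, lowerParts φ n i ≤ n := by
  rcases n.eq_zero_or_pos with rfl | hn
  · simp
  have h := integral_phiOf hn (l := lowerParts φ n) fun i hi => lowerParts_eq_zero hxφ hi
  have hle : ∫ x in Set.Ioi (0 : ℝ), phiOf n (lowerParts φ n) x ≤ 1 := by
    rw [← h1]
    exact integral_mono_of_nonneg (Eventually.of_forall fun x => phiOf_nonneg _ _ x) hi
      (Eventually.of_forall fun x => phiOf_lowerParts_le_self hφ h0 n x)
  rw [h, div_le_one (by exact_mod_cast hn)] at hle
  exact_mod_cast hle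

lemma isPartitionOf_approxParts (hφ : Antitone φ) (h0 : ∀ x, 0 ≤ φ x)
    (hi : IntegrableOn φ (Set.Ioi 0)) (h1 : ∫ x in Set.Ioi (0 : ℝ), φ x = 1)
    (hxφ : ∀ x, 0 < x → x * φ x ≤ 1) (n : ℕ) : IsPartitionOf n (approxParts φ n) := by
  refine ⟨fun i j hij => antitone_approxParts hφ n hij,
    ⟨_, fun i hi => approxParts_eq_zero hxφ hi⟩, ?_⟩
  rw [tsum_eq_sum (s := Finset.range (n + n.sqrt + 1)) fun i hi => by
    rw [approxParts_eq_zero hxφ (by simpa using hi), Nat.cast_zero]]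
  norm_cast
  have e1 : ∑ i ∈ Finset.range (n + n.sqrt + 1), lowerParts φ n i
      = ∑ i ∈ Finset.range n, lowerParts φ n i :=
    (Finset.sum_subset (Finset.range_mono (by omega)) fun i _ hi =>
      lowerParts_eq_zero hxφ (by simpa using hi)).symm
  have e2 : ∑ i ∈ Finset.range (n + n.sqrt + 1), evenParts (n.sqrt + 1) (missingCells φ n) i
      = missingCells φ n := by
    refine Eq.trans ?_ (sum_evenParts n.sqrt.succ_pos (missingCells φ n))
    exact (Finset.sum_subset (Finset.range_mono (by omega)) fun i _ hi =>
      evenParts_eq_zero (by simpa using hi)).symm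
  simp only [approxParts, Finset.sum_add_distrib]
  rw [e1, e2, missingCells]
  exact Nat.add_sub_cancel' (sum_lowerParts_le hφ h0 hi h1 hxφ n)

lemma ae_tendsto_phiOf_lowerParts (hφ : Antitone φ) (h0 : ∀ x, 0 ≤ φ x) :
    ∀ᵐ x, 0 < x → Tendsto (fun n => phiOf n (lowerParts φ n) x) atTop (𝓝 (φ x)) := by
  filter_upwards [hφ.countable_not_continuousAt.ae_notMem volume] with x hx hx0
  exact tendsto_phiOf_lowerParts h0 hx0 (not_not.1 hx)

lemma tendsto_missingCells_div (hφ : Antitone φ) (h0 : ∀ x, 0 ≤ φ x)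
    (hi : IntegrableOn φ (Set.Ioi 0)) (h1 : ∫ x in Set.Ioi (0 : ℝ), φ x = 1)
    (hxφ : ∀ x, 0 < x → x * φ x ≤ 1) :
    Tendsto (fun n => (missingCells φ n : ℝ) / n) atTop (𝓝 0) := by
  have hlim : Tendsto (fun n => ∫ x in Set.Ioi (0 : ℝ), phiOf n (lowerParts φ n) x) atTop
      (𝓝 (∫ x in Set.Ioi (0 : ℝ), φ x)) := by
    refine tendsto_integral_of_dominated_convergence φ
      (fun n => (antitone_phiOf n (antitone_lowerParts hφ n)).measurable.aestronglyMeasurable) hi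
      (fun n => Eventually.of_forall fun x => ?_)
      ((ae_restrict_iff' measurableSet_Ioi).2 (ae_tendsto_phiOf_lowerParts hφ h0))
    rw [Real.norm_of_nonneg (phiOf_nonneg _ _ _)]
    exact phiOf_lowerParts_le_self hφ h0 n x
  rw [h1] at hlim
  have := hlim.const_sub 1
  rw [sub_self] at this
  refine this.congr' ?_
  filter_upwards [eventually_gt_atTop 0] with n hn
  have hn' : (n : ℝ) ≠ 0 := by exact_mod_cast hn.ne'
  rw [integral_phiOf hn fun i hi => lowerParts_eq_zero hxφ hi, missingCells,
    Nat.cast_sub (sum_lowerParts_le hφ h0 hi h1 hxφ n), sub_div, div_self hn', Nat.cast_sum]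

lemma ae_tendsto_phiOf_approxParts (hφ : Antitone φ) (h0 : ∀ x, 0 ≤ φ x)
    (hi : IntegrableOn φ (Set.Ioi 0)) (h1 : ∫ x in Set.Ioi (0 : ℝ), φ x = 1)
    (hxφ : ∀ x, 0 < x → x * φ x ≤ 1) :
    ∀ᵐ x, 0 < x → Tendsto (fun n => phiOf n (approxParts φ n) x) atTop (𝓝 (φ x)) := by
  filter_upwards [ae_tendsto_phiOf_lowerParts hφ h0] with x hx hx0
  have hinv : Tendsto (fun n : ℕ => 1 / √(n : ℝ)) atTop (𝓝 0) :=
    tendsto_const_nhds.div_atTop tendsto_sqrt_natCast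
  have hb := (tendsto_missingCells_div hφ h0 hi h1 hxφ).add hinv
  rw [add_zero] at hb
  have he : Tendsto (fun n => phiOf n (evenParts (n.sqrt + 1) (missingCells φ n)) x) atTop (𝓝 0) :=
    squeeze_zero (fun n => phiOf_nonneg _ _ _) (fun n => phiOf_evenParts_le _ _ _) hb
  simpa only [phiOf_approxParts, add_zero] using (hx hx0).add he

lemma tendsto_integral_abs_phiOf_approxParts_sub (hφ : Antitone φ) (h0 : ∀ x, 0 ≤ φ x)
    (hi : IntegrableOn φ (Set.Ioi 0)) (h1 : ∫ x in Set.Ioi (0 : ℝ), φ x = 1)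
    (hxφ : ∀ x, 0 < x → x * φ x ≤ 1) :
    Tendsto (fun n => ∫ x in Set.Ioi (0 : ℝ), |phiOf n (approxParts φ n) x - φ x|) atTop
      (𝓝 0) := by
  have hbound : IntegrableOn (fun x => φ x + (Set.Iic 2).indicator (fun _ => (2 : ℝ)) x)
      (Set.Ioi 0) := by
    refine hi.add ?_
    rw [IntegrableOn, integrable_indicator_iff measurableSet_Iic, IntegrableOn,
      Measure.restrict_restrict measurableSet_Iic, Set.inter_comm, Set.Ioi_inter_Iic]
    exact integrableOn_const (by simp)
  have key := tendsto_integral_of_dominated_convergence (μ := volume.restrict (Set.Ioi 0))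
    (F := fun n x => |phiOf n (approxParts φ n) x - φ x|) (f := fun _ => 0) _
    (fun n => ((antitone_phiOf n (antitone_approxParts hφ n)).measurable.sub
      hφ.measurable).abs.aestronglyMeasurable) hbound ?_ ?_
  · simpa using key
  · refine fun n => Eventually.of_forall fun x => ?_
    have a1 := phiOf_lowerParts_le_self hφ h0 n x
    have a2 := phiOf_nonneg n (lowerParts φ n) x
    have a3 := phiOf_nonneg n (evenParts (n.sqrt + 1) (missingCells φ n)) x
    have a4 : phiOf n (evenParts (n.sqrt + 1) (missingCells φ n)) x
        ≤ (Set.Iic 2).indicator (fun _ => (2 : ℝ)) x := by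
      by_cases hx : x ≤ 2
      · rw [Set.indicator_of_mem (show x ∈ Set.Iic 2 from hx)]
        exact phiOf_evenParts_missingCells_le_two n x
      · rw [Set.indicator_of_notMem (show x ∉ Set.Iic 2 from hx),
          phiOf_evenParts_eq_zero _ _ (not_le.1 hx)]
    have a5 := h0 x
    rw [Real.norm_eq_abs, abs_abs, phiOf_approxParts, abs_le]
    constructor <;> linarith
  · refine (ae_restrict_iff' measurableSet_Ioi).2 ?_
    filter_upwards [ae_tendsto_phiOf_approxParts hφ h0 hi h1 hxφ] with x hx hx0
    simpa using ((hx hx0).sub_const (φ x)).abs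

/-- The approximation theorem for shapes that are antitone on the whole real line. -/
theorem hook_integral_approx_of_antitone (hφ : Antitone φ) (h0 : ∀ x, 0 ≤ φ x)
    (h1 : ∫ x in Set.Ioi (0 : ℝ), φ x = 1)
    (hfin : IntegrableOn (fun p => Real.log (hookLength φ p)) (hookRegion φ)) :
    ∃ l : ℕ → ℕ → ℕ, (∀ n, IsPartitionOf n (l n)) ∧
      Tendsto (fun n => ∫ x in Set.Ioi (0 : ℝ), |phiOf n (l n) x - φ x|) atTop (𝓝 0) ∧
      Tendsto (fun n => Ihook (phiOf n (l n))) atTop (𝓝 (Ihook φ)) := by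
  have hi : IntegrableOn φ (Set.Ioi 0) := by
    by_contra h
    rw [integral_undef h] at h1
    exact zero_ne_one h1
  have hxφ : ∀ x, 0 < x → x * φ x ≤ 1 := fun x hx =>
    (mul_le_integral_of_antitone hφ h0 hi hx).trans_eq h1
  have hshape : IsShape φ :=
    ⟨hφ, h0, fun y hy => ⟨y⁻¹, by positivity, by
      have := hxφ y⁻¹ (by positivity)
      rwa [inv_mul_le_iff₀ hy, mul_one] at this⟩⟩
  refine ⟨approxParts φ, isPartitionOf_approxParts hφ h0 hi h1 hxφ,
    tendsto_integral_abs_phiOf_approxParts_sub hφ h0 hi h1 hxφ, ?_⟩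
  refine hshape.tendsto_integral_log_hookLength (M := φ 0 + 2)
    (fun n => isShape_phiOf n (antitone_approxParts hφ n) fun i hi => approxParts_eq_zero hxφ hi)
    (fun n x => ?_) (fun n x hx => ?_) hxφ (volume_hookRegion_ne_top hφ hi) hfin
    (ae_tendsto_phiOf_approxParts hφ h0 hi h1 hxφ)
  · rw [phiOf_approxParts]
    exact add_le_add ((phiOf_lowerParts_le hφ h0 n x).trans (hφ (le_max_right _ _)))
      (phiOf_evenParts_missingCells_le_two n x)
  · rw [phiOf_approxParts, phiOf_evenParts_eq_zero _ _ hx, add_zero]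
    exact phiOf_lowerParts_le_self hφ h0 n x

end Approximation

section Restriction

variable {φ ψ : ℝ → ℝ}

lemma phiInv_congr (h : Set.EqOn φ ψ (Set.Ici 0)) : phiInv φ = phiInv ψ := by
  ext y
  unfold phiInv
  congr 1
  ext x
  exact and_congr_right fun hx => by rw [h hx]

lemma hookRegion_congr (h : Set.EqOn φ ψ (Set.Ici 0)) : hookRegion φ = hookRegion ψ := by
  ext p
  exact and_congr_right fun hx => by rw [h (show 0 ≤ p.1 from hx.le)]

lemma eqOn_hookLength (h : Set.EqOn φ ψ (Set.Ici 0)) :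
    Set.EqOn (hookLength φ) (hookLength ψ) (hookRegion ψ) := fun p hp => by
  rw [hookLength, hookLength, h (show 0 ≤ p.1 from hp.1.le), phiInv_congr h]

end Restriction

/-- For `φ ∈ 𝒴₁` with finite hook integral, there are partitions `λ^{(n)} ⊢ n` whose
rescaled shapes converge to `φ` in `L¹` and whose hook integrals converge to `I_hook(φ)`. -/
theorem hook_integral_approx (φ : ℝ → ℝ) (hφ : MemYone φ)
    (hfin : IntegrableOn
      (fun p : ℝ × ℝ => Real.log (φ p.1 + phiInv φ p.2 - p.1 - p.2))
      {p : ℝ × ℝ | 0 < p.1 ∧ 0 < p.2 ∧ p.2 < φ p.1}) :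
    ∃ l : ℕ → ℕ → ℕ, (∀ n, IsPartitionOf n (l n)) ∧
      Tendsto (fun n => ∫ x in Set.Ioi (0 : ℝ), |phiOf n (l n) x - φ x|) atTop (nhds 0) ∧
      Tendsto (fun n => Ihook (phiOf n (l n))) atTop (nhds (Ihook φ)) := by
  set ψ : ℝ → ℝ := fun x => φ (max x 0) with hψ
  have heq : Set.EqOn ψ φ (Set.Ici 0) := fun x hx => by simp [hψ, max_eq_left hx.out]
  have hanti : Antitone ψ := fun x y hxy =>
    hφ.2.1 (le_max_right x 0) (le_max_right y 0) (max_le_max_right 0 hxy)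
  have heq' : Set.EqOn ψ φ (Set.Ioi 0) := heq.mono Set.Ioi_subset_Ici_self
  have hlog : Set.EqOn (fun p => Real.log (hookLength ψ p)) (fun p => Real.log (hookLength φ p))
      (hookRegion ψ) := fun p hp =>
    congrArg Real.log (eqOn_hookLength heq (hookRegion_congr heq ▸ hp))
  have hm := measurableSet_hookRegion hanti.measurable
  have hfin' : IntegrableOn (fun p => Real.log (hookLength ψ p)) (hookRegion ψ) := by
    rw [integrableOn_congr_fun hlog hm, hookRegion_congr heq]
    exact hfin
  have hI : Ihook ψ = Ihook φ := by
    change ∫ p in hookRegion ψ, Real.log (hookLength ψ p)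
      = ∫ p in hookRegion φ, Real.log (hookLength φ p)
    rw [setIntegral_congr_fun hm hlog, hookRegion_congr heq]
  obtain ⟨l, hl, hL, hH⟩ := hook_integral_approx_of_antitone hanti
    (fun x => hφ.1 _ (le_max_right _ _))
    ((setIntegral_congr_fun measurableSet_Ioi heq').trans hφ.2.2) hfin'
  refine ⟨l, hl, hL.congr fun n => ?_, hI ▸ hH⟩
  exact setIntegral_congr_fun measurableSet_Ioi fun x hx => by simp only [heq' hx]
end
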